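/- Let p be a prime, let s ≥ 1 be an integer, and set n = sp. Then 4 times the number of pairs (i,j) of nonnegative integers with i+j ≤ n−2 that are not Hurwitz-admissible for n and p equals s(s+1)p(p−1). (Equivalently, the a-number of the Hurwitz curve H_{sp} is a(H_{sp}) = s(s+1)p(p−1)/4.) -/

import Mathlib

/-- A pair `(i, j)` is *Hurwitz-admissible* for `n` and `p` if there exist integers
`h, k` with `0 ≤ h ≤ p - 1` and `0 ≤ k ≤ h` such that `n*k - h + i ≡ 0 (mod p)`
and `n*(h-k) + k + j ≡ p-1 (mod p)`. -/
def HurwitzAdmissible (n p i j : ℕ) : Prop :=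
  ∃ h k : ℕ, h ≤ p - 1 ∧ k ≤ h ∧
    ((n : ℤ) * k - h + i ≡ 0 [ZMOD (p : ℤ)]) ∧
    ((n : ℤ) * ((h : ℤ) - k) + k + j ≡ (p : ℤ) - 1 [ZMOD (p : ℤ)])

/-- The pairs of natural numbers with sum less than `m`. -/
def pairsSumLT (m : ℕ) : Finset (ℕ × ℕ) :=
  (Finset.range m).biUnion Finset.HasAntidiagonal.antidiagonal

theorem mem_pairsSumLT {m : ℕ} {x : ℕ × ℕ} : x ∈ pairsSumLT m ↔ x.1 + x.2 < m := by
  simp [pairsSumLT]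

theorem two_mul_card_pairsSumLT (m : ℕ) : 2 * (pairsSumLT m).card = m * (m + 1) := by
  have hcard : (pairsSumLT m).card = ∑ i ∈ Finset.range m, (i + 1) := by
    rw [pairsSumLT, Finset.card_biUnion]
    · simp
    · intro a _ b _ hab
      rw [Function.onFun, Finset.disjoint_left]
      intro x hxa hxb
      rw [Finset.HasAntidiagonal.mem_antidiagonal] at hxa hxb
      exact hab (hxa.symm.trans hxb)
  rw [hcard]
  clear hcard
  induction m with
  | zero => simp
  | succ m ih => rw [Finset.sum_range_succ, mul_add, ih]; ring

/-- When `p ∣ n`, the congruences force `h = i % p` and `k = p - 1 - j % p`. -/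
theorem hurwitzAdmissible_mul_iff {p : ℕ} (hp : 0 < p) (s i j : ℕ) :
    HurwitzAdmissible (s * p) p i j ↔ p - 1 ≤ i % p + j % p := by
  have hi := Nat.mod_lt i hp
  have hj := Nat.mod_lt j hp
  have hi' : (p : ℤ) * (i / p : ℕ) + (i % p : ℕ) = i := mod_cast Nat.div_add_mod i p
  have hj' : (p : ℤ) * (j / p : ℕ) + (j % p : ℕ) = j := mod_cast Nat.div_add_mod j p
  constructor
  · rintro ⟨h, k, hh, hk, h1, h2⟩
    have e1 : h = i % p := by
      have : h ≡ i [MOD p] := by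
        rw [← Int.natCast_modEq_iff, Int.modEq_iff_dvd]
        obtain ⟨c, hc⟩ := h1.symm.dvd
        refine ⟨c - s * k, ?_⟩
        push_cast at hc
        linear_combination hc
      rw [← this, Nat.mod_eq_of_lt (by omega)]
    have e2 : k + j % p = p - 1 := by
      have hd : (p : ℤ) ∣ ((k : ℤ) + (j % p : ℕ) + 1) := by
        obtain ⟨c, hc⟩ := h2.symm.dvd
        refine ⟨c - s * (h - k) - (j / p : ℕ) + 1, ?_⟩
        simp only [Nat.cast_mul] at hc
        linear_combination hc + hj'
      have hd' : p ∣ k + j % p + 1 := mod_cast hd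
      obtain ⟨c, hc⟩ := hd'
      have hc2 : c < 2 := by
        by_contra hc2
        have := Nat.mul_le_mul_left p (not_lt.mp hc2)
        omega
      interval_cases c <;> omega
    omega
  · intro hle
    refine ⟨i % p, p - 1 - j % p, by omega, by omega, ?_, ?_⟩
    · refine (Int.modEq_iff_dvd.mpr ⟨s * (p - 1 - j % p : ℕ) + (i / p : ℕ), ?_⟩).symm
      simp only [Nat.cast_mul]
      linear_combination -hi'
    · have hk : ((p - 1 - j % p : ℕ) : ℤ) = p - 1 - (j % p : ℕ) := by omega
      refine (Int.modEq_iff_dvd.mpr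
        ⟨s * ((i % p : ℕ) - (p - 1 - j % p : ℕ)) + (j / p : ℕ), ?_⟩).symm
      simp only [Nat.cast_mul]
      linear_combination hk - hj'

/-- The pair with base-`p` quotients `x.1` and remainders `x.2`. -/
def pairOfDivMod (p : ℕ) (x : (ℕ × ℕ) × (ℕ × ℕ)) : ℕ × ℕ :=
  (p * x.1.1 + x.2.1, p * x.1.2 + x.2.2)

theorem injOn_pairOfDivMod {p : ℕ} (s : ℕ) :
    Set.InjOn (pairOfDivMod p) (pairsSumLT s ×ˢ pairsSumLT (p - 1) : Finset _) := by
  rintro ⟨⟨a, b⟩, r, t⟩ hx ⟨⟨a', b'⟩, r', t'⟩ hy hxy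
  simp only [Finset.coe_product, Set.mem_prod, Finset.mem_coe, mem_pairsSumLT] at hx hy
  simp only [pairOfDivMod, Prod.mk.injEq] at hxy
  have key : ∀ {c u c' u' : ℕ}, u < p → u' < p → p * c + u = p * c' + u' →
      c = c' ∧ u = u' := by
    intro c u c' u' hu hu' h
    have hm := congrArg (· % p) h
    have hd := congrArg (· / p) h
    simp only [Nat.mul_add_mod, Nat.mod_eq_of_lt hu, Nat.mod_eq_of_lt hu'] at hm
    simp only [Nat.mul_add_div (by omega : p > 0), Nat.div_eq_of_lt hu,
      Nat.div_eq_of_lt hu', add_zero] at hd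
    exact ⟨hd, hm⟩
  obtain ⟨rfl, rfl⟩ := key (by omega) (by omega) hxy.1
  obtain ⟨rfl, rfl⟩ := key (by omega) (by omega) hxy.2
  rfl

theorem setOf_not_hurwitzAdmissible_eq_image {p s : ℕ} (hp : 2 ≤ p) (hs : 1 ≤ s) :
    {ij : ℕ × ℕ | ij.1 + ij.2 ≤ s * p - 2 ∧ ¬ HurwitzAdmissible (s * p) p ij.1 ij.2} =
      pairOfDivMod p '' (pairsSumLT s ×ˢ pairsSumLT (p - 1) : Finset _) := by
  have hsp : p ≤ s * p := Nat.le_mul_of_pos_left p hs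
  ext ⟨i, j⟩
  simp only [Set.mem_ofPred_eq, hurwitzAdmissible_mul_iff (by omega : 0 < p), not_le,
    Set.mem_image, Finset.coe_product, Set.mem_prod, Finset.mem_coe, mem_pairsSumLT]
  constructor
  · rintro ⟨hle, hlt⟩
    refine ⟨((i / p, j / p), (i % p, j % p)), ⟨?_, hlt⟩, ?_⟩
    · have hi := Nat.div_add_mod i p
      have hj := Nat.div_add_mod j p
      by_contra hge
      have : p * s ≤ p * (i / p + j / p) := Nat.mul_le_mul_left p (not_lt.mp hge)
      rw [mul_comm p s, mul_add] at this
      omega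
    · simp only [pairOfDivMod, Nat.div_add_mod]
  · rintro ⟨⟨⟨a, b⟩, r, t⟩, ⟨hab, hrt⟩, hx⟩
    simp only [pairOfDivMod, Prod.mk.injEq] at hab hrt hx
    obtain ⟨rfl, rfl⟩ := hx
    rw [Nat.mul_add_mod, Nat.mul_add_mod, Nat.mod_eq_of_lt (by omega : r < p),
      Nat.mod_eq_of_lt (by omega : t < p)]
    refine ⟨?_, hrt⟩
    have := Nat.mul_le_mul_left p (Nat.succ_le_of_lt hab)
    rw [mul_comm p s, Nat.mul_succ, mul_add] at this
    omega

/-- The `a`-number of the Hurwitz curve `H_{sp}` is `s*(s+1)*p*(p-1)/4`. -/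
theorem four_mul_card_not_hurwitzAdmissible_sp
    (p s n : ℕ) (hp : p.Prime) (hs : 1 ≤ s) (hn : n = s * p) :
    4 * {ij : ℕ × ℕ | ij.1 + ij.2 ≤ n - 2 ∧
          ¬ HurwitzAdmissible n p ij.1 ij.2}.ncard
      = s * (s + 1) * p * (p - 1) := by
  subst hn
  rw [setOf_not_hurwitzAdmissible_eq_image hp.two_le hs,
    (injOn_pairOfDivMod s).ncard_image, Set.ncard_coe_finset, Finset.card_product]
  have h := congrArg₂ (· * ·) (two_mul_card_pairsSumLT s) (two_mul_card_pairsSumLT (p - 1))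
  simp only [Nat.sub_add_cancel hp.one_le] at h
  linarith
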